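/- arXiv:2011.13077 — 2 statements merged into one kernel-verified Lean document; each statement's English description precedes it below -/
import Mathlib

section
/- For every x ∈ H one has ‖V(x)‖_H ≤ ‖x‖_H; in particular the operator norm of V is at most 1. -/
open MeasureTheory RealInnerProductSpace

noncomputable section

/-- `H` is the real Hilbert space `L²([0,1])`. -/
abbrev H : Type :=
  MeasureTheory.Lp ℝ 2 (MeasureTheory.volume : MeasureTheory.Measure (Set.Icc (0:ℝ) 1))

/-- Synthesis from an orthonormal family after analysis against it does not increase the norm. -/
theorem Orthonormal.norm_sum_inner_smul_le {ι E : Type*} [Fintype ι] [NormedAddCommGroup E]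
    [InnerProductSpace ℝ E] {v : ι → E} (hv : Orthonormal ℝ v) (x : E) :
    ‖∑ i, ⟪x, v i⟫ • v i‖ ≤ ‖x‖ := by
  refine le_of_sq_le_sq ?_ (norm_nonneg x)
  rw [← real_inner_self_eq_norm_sq, hv.inner_sum]
  refine le_trans (le_of_eq ?_) (hv.sum_inner_products_le (s := Finset.univ) x)
  refine Finset.sum_congr rfl fun i _ => ?_
  rw [real_inner_comm, Real.norm_eq_abs, sq_abs, sq]
  rfl

/-- The components at a fixed index of an orthonormal family in an `ℓ²` direct sum form a
Bessel system with bound `1`. -/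
theorem Orthonormal.norm_sum_inner_apply_smul_le {ι κ E : Type*} [Fintype ι] [Fintype κ]
    [NormedAddCommGroup E] [InnerProductSpace ℝ E] {v : ι → PiLp 2 (fun _ : κ => E)}
    (hv : Orthonormal ℝ v) (j : κ) (x : E) :
    ‖∑ i, ⟪x, v i j⟫ • v i j‖ ≤ ‖x‖ := by
  classical
  let e : PiLp 2 (fun _ : κ => E) := PiLp.single 2 j x
  have inner_e (y : PiLp 2 (fun _ : κ => E)) : ⟪e, y⟫ = ⟪x, y j⟫ := by
    rw [PiLp.inner_apply, Finset.sum_eq_single j] <;> simp +contextual [e]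
  calc ‖∑ i, ⟪x, v i j⟫ • v i j‖ = ‖(∑ i, ⟪e, v i⟫ • v i) j‖ := by simp [inner_e]
    _ ≤ ‖∑ i, ⟪e, v i⟫ • v i‖ := PiLp.norm_apply_le _ j
    _ ≤ ‖e‖ := hv.norm_sum_inner_smul_le e
    _ = ‖x‖ := by simp [e]

theorem fssa_V_contraction
    (L k : ℕ) (hL : 2 ≤ L) (hk : 1 ≤ k)
    (ψ : Fin k → PiLp 2 (fun _ : Fin L => H))
    (hψ : Orthonormal ℝ ψ)
    (π : Fin k → H) (hπ : ∀ n, π n = ψ n ⟨L - 1, by omega⟩)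
    (V : H →L[ℝ] H)
    (hV : ∀ x, V x = ∑ n : Fin k, ⟪x, π n⟫ • π n) :
    (∀ x : H, ‖V x‖ ≤ ‖x‖) ∧ ‖V‖ ≤ 1 := by
  have le_norm (x : H) : ‖V x‖ ≤ ‖x‖ := by
    simp only [hV, hπ]
    exact hψ.norm_sum_inner_apply_smul_le _ x
  exact ⟨le_norm, V.opNorm_le_bound zero_le_one fun x => by simpa using le_norm x⟩
end
end

section
/- Assume each π_n lies in H_d. Then for every integer l ≥ 0, the d×k matrix with (i,n) entry ⟨V^l(π_n), ν_i⟩_H equals G^{1/2} D (DᵀD)^l. -/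
open MeasureTheory RealInnerProductSpace Matrix

noncomputable section

/-- On the span of `v`, the powers of the frame operator of a finite family `v` act through the
powers of the Gram matrix of `v`. -/
theorem frameOperator_pow_apply {E ι : Type*} [NormedAddCommGroup E] [InnerProductSpace ℝ E]
    [Fintype ι] [DecidableEq ι] (v : ι → E) (V : E →L[ℝ] E)
    (hV : ∀ x, V x = ∑ n, ⟪x, v n⟫ • v n) (l : ℕ) (n : ι) :
    (V ^ l) (v n) = ∑ m, (gram ℝ v ^ l) m n • v m := by
  induction l with
  | zero => simp [Matrix.one_apply]
  | succ l ih =>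
    rw [pow_succ' V, mul_apply_eq_comp, ih, map_sum, pow_succ' (gram ℝ v)]
    simp only [hV, Matrix.mul_apply, Finset.sum_smul]
    rw [Finset.sum_comm]
    refine Finset.sum_congr rfl fun p _ => Finset.sum_congr rfl fun m _ => ?_
    rw [gram_apply, real_inner_smul_left, real_inner_comm, mul_comm]

/-- Inner products of linear combinations of `ν` with the members of `ν`, in matrix form. -/
theorem of_inner_sum_smul_eq_gram_mul {E ι κ : Type*} [NormedAddCommGroup E]
    [InnerProductSpace ℝ E] [Fintype ι] (ν : ι → E) (C : Matrix ι κ ℝ) :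
    (Matrix.of fun i n => ⟪∑ j, C j n • ν j, ν i⟫) = gram ℝ ν * C := by
  ext i n
  simp only [of_apply, sum_inner, real_inner_smul_left, Matrix.mul_apply, gram_apply]
  exact Finset.sum_congr rfl fun j _ => by rw [real_inner_comm, mul_comm]

/-- The Gram matrix of linear combinations of `ν` in terms of the Gram matrix of `ν`. -/
theorem gram_sum_smul {E ι κ : Type*} [NormedAddCommGroup E] [InnerProductSpace ℝ E]
    [Fintype ι] (ν : ι → E) (C : Matrix ι κ ℝ) :
    gram ℝ (fun n => ∑ j, C j n • ν j) = Cᵀ * (gram ℝ ν * C) := by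
  rw [← of_inner_sum_smul_eq_gram_mul]
  ext m n
  rw [gram_apply, sum_inner, Matrix.mul_apply]
  exact Finset.sum_congr rfl fun j _ => by
    rw [real_inner_smul_left, transpose_apply, of_apply, real_inner_comm]

theorem fssa_Vpow_matrix
    (L k d : ℕ) (hL : 2 ≤ L) (hk : 1 ≤ k)
    (ψ : Fin k → PiLp 2 (fun _ : Fin L => H))
    (hψ : Orthonormal ℝ ψ)
    (π : Fin k → H) (hπ : ∀ n, π n = ψ n ⟨L - 1, by omega⟩)
    (V : H →L[ℝ] H)
    (hV : ∀ x, V x = ∑ n : Fin k, ⟪x, π n⟫ • π n)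
    -- the basis `ν` of the `d`-dimensional subspace `H_d`
    (ν : Fin d → H) (hν : LinearIndependent ℝ ν)
    -- the Gram matrix `G` and its positive-definite square root `Gs`
    (G : Matrix (Fin d) (Fin d) ℝ) (hG : ∀ i j, G i j = ⟪ν i, ν j⟫)
    (Gs : Matrix (Fin d) (Fin d) ℝ) (hGs : Gs.PosDef ∧ Gs * Gs = G)
    -- each `π n` lies in `H_d`, with coefficient vector `cπ n`
    (cπ : Fin k → Fin d → ℝ) (hcπ : ∀ n, π n = ∑ i : Fin d, cπ n i • ν i)
    (D : Matrix (Fin d) (Fin k) ℝ) (hD : D = Gs * Matrix.of (fun i n => cπ n i)) :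
    ∀ l : ℕ,
      (Matrix.of fun (i : Fin d) (n : Fin k) => ⟪(V ^ l) (π n), ν i⟫) =
        Gs * D * (Dᵀ * D) ^ l := by
  intro l
  obtain ⟨hpos, hsq⟩ := hGs
  have hGram : gram ℝ ν = Gs * Gs := by
    rw [hsq]
    ext i j
    rw [gram_apply, hG]
  have hsymm : Gsᵀ = Gs := by
    simpa [conjTranspose_eq_transpose_of_trivial] using hpos.isHermitian.eq
  set C : Matrix (Fin d) (Fin k) ℝ := Matrix.of fun i n => cπ n i
  have hπC : π = fun n => ∑ j, C j n • ν j := funext hcπ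
  have hπν : (Matrix.of fun i n => ⟪π n, ν i⟫) = Gs * D := by
    rw [hπC, of_inner_sum_smul_eq_gram_mul, hGram, hD, Matrix.mul_assoc]
  have hπGram : gram ℝ π = Dᵀ * D := by
    rw [hπC, gram_sum_smul, hGram, hD, transpose_mul, hsymm]
    simp only [Matrix.mul_assoc]
  rw [← hπν, ← hπGram]
  ext i n
  rw [of_apply, frameOperator_pow_apply π V hV, sum_inner, Matrix.mul_apply]
  exact Finset.sum_congr rfl fun m _ => by rw [real_inner_smul_left, of_apply, mul_comm]
end
end
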